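/- Let G : Y ⊆ ℝ^d → ℝ^d be continuous with a unique zero y_ex in the open set Y, and suppose G has a Lipschitz inverse on a neighborhood V of 0 ∈ ℝ^d, i.e., there is C > 0 with ‖G^{-1}(b) − y_ex‖ ≤ C‖b‖ for all b ∈ V. Let G^h : Y → ℝ^d be continuous with sup_{y∈Y} ‖G(y) − G^h(y)‖ ≤ M h^k. Then for all sufficiently small h > 0 there exists y^h ∈ Y with G^h(y^h) = 0 and ‖y^h − y_ex‖ ≤ C M h^k. -/

import Mathlib

open Metric Set MeasureTheory Topology

theorem br_det_interp {d : ℕ} (A : EuclideanSpace ℝ (Fin d) →L[ℝ] EuclideanSpace ℝ (Fin d))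
    (v : ℕ → ℝ) (hv : InjOn v (Finset.range (d + 1) : Finset ℕ)) (t : ℝ) :
    (ContinuousLinearMap.id ℝ (EuclideanSpace ℝ (Fin d)) + t • A).det =
      ∑ i ∈ Finset.range (d + 1), (Lagrange.basis (Finset.range (d + 1)) v i).eval t *
        (ContinuousLinearMap.id ℝ (EuclideanSpace ℝ (Fin d)) + v i • A).det := by
  obtain ⟨q, hq, hev⟩ : ∃ q : Polynomial ℝ, q.natDegree ≤ d ∧ ∀ s : ℝ, q.eval s =
      (ContinuousLinearMap.id ℝ (EuclideanSpace ℝ (Fin d)) + s • A).det := by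
    let b := (EuclideanSpace.basisFun (Fin d) ℝ).toBasis
    let m := LinearMap.toMatrix b b (A : EuclideanSpace ℝ (Fin d) →ₗ[ℝ] EuclideanSpace ℝ (Fin d))
    refine ⟨Matrix.det ((Polynomial.X : Polynomial ℝ) • m.map Polynomial.C
      + (1 : Matrix (Fin d) (Fin d) ℝ).map Polynomial.C), ?_, ?_⟩
    · simpa using Polynomial.natDegree_det_X_add_C_le m 1
    · intro s
      rw [← Polynomial.coe_evalRingHom, RingHom.map_det, ContinuousLinearMap.det,
        ← LinearMap.det_toMatrix b]
      congr 1
      have h1 : LinearMap.toMatrix b b ((ContinuousLinearMap.id ℝ (EuclideanSpace ℝ (Fin d)) + s • A :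
          EuclideanSpace ℝ (Fin d) →L[ℝ] EuclideanSpace ℝ (Fin d)) :
          EuclideanSpace ℝ (Fin d) →ₗ[ℝ] EuclideanSpace ℝ (Fin d)) = 1 + s • m := by
        rw [ContinuousLinearMap.toLinearMap_add, ContinuousLinearMap.toLinearMap_smul, map_add, map_smul,
          ContinuousLinearMap.coe_id, LinearMap.toMatrix_id]
      rw [h1]
      ext i j
      by_cases hij : i = j <;> simp [hij, add_comm] <;> ring
  have h := Lagrange.eq_interpolate (f := q) hv (by
    rw [Finset.card_range]
    refine lt_of_le_of_lt Polynomial.degree_le_natDegree ?_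
    exact_mod_cast Nat.lt_succ_of_le hq)
  rw [← hev t, h, Lagrange.interpolate_apply, Polynomial.eval_finsetSum]
  refine Finset.sum_congr rfl fun i hi => ?_
  rw [Polynomial.eval_mul, Polynomial.eval_C, hev, mul_comm]

theorem br_image {d : ℕ} (g : EuclideanSpace ℝ (Fin d) → EuclideanSpace ℝ (Fin d)) (K : NNReal)
    (hgc : Continuous g)
    (hK : LipschitzOnWith K g (closedBall 0 2))
    (hg0 : ∀ x, ‖x‖ = 2 → g x = 0) (hg2 : ∀ x, ‖x + g x‖ = 2)
    (t : ℝ) (ht0 : 0 < t) (ht1 : t < 1) (htK : t * K < 1) :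
    InjOn (fun x => x + t • g x) (ball 0 2) ∧ (fun x => x + t • g x) '' (ball 0 2) = ball 0 2 := by
  have happ : ApproximatesLinearOn (fun x => x + t • g x)
      ((ContinuousLinearEquiv.refl ℝ (EuclideanSpace ℝ (Fin d)) :
        EuclideanSpace ℝ (Fin d) ≃L[ℝ] EuclideanSpace ℝ (Fin d)) :
        EuclideanSpace ℝ (Fin d) →L[ℝ] EuclideanSpace ℝ (Fin d)) (ball 0 2)
      (t.toNNReal * K) := by
    intro x hx y hy
    have h1 := hK.norm_sub_le (ball_subset_closedBall hx) (ball_subset_closedBall hy)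
    have h2 : x + t • g x - (y + t • g y) - (x - y) = t • (g x - g y) := by
      rw [smul_sub]; abel
    simp only [ContinuousLinearEquiv.coe_refl, ContinuousLinearMap.id_apply, h2]
    rw [norm_smul, Real.norm_of_nonneg ht0.le, NNReal.coe_mul, Real.coe_toNNReal _ ht0.le, mul_assoc]
    gcongr
  have hc : Subsingleton (EuclideanSpace ℝ (Fin d)) ∨ t.toNNReal * K <
      ‖((ContinuousLinearEquiv.refl ℝ (EuclideanSpace ℝ (Fin d))).symm :
        EuclideanSpace ℝ (Fin d) →L[ℝ] EuclideanSpace ℝ (Fin d))‖₊⁻¹ := by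
    rcases subsingleton_or_nontrivial (EuclideanSpace ℝ (Fin d)) with h | h
    · exact Or.inl h
    · right
      have : ‖((ContinuousLinearEquiv.refl ℝ (EuclideanSpace ℝ (Fin d))).symm :
        EuclideanSpace ℝ (Fin d) →L[ℝ] EuclideanSpace ℝ (Fin d))‖₊ = 1 := by
        simp
      rw [this, inv_one, ← NNReal.coe_lt_coe, NNReal.coe_mul, Real.coe_toNNReal _ ht0.le]
      exact_mod_cast htK
  have hform : ∀ x, ‖x + t • g x‖ ≤ (1 - t) * ‖x‖ + t * 2 := by
    intro x
    have : x + t • g x = (1 - t) • x + t • (x + g x) := by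
      rw [sub_smul, smul_add, one_smul]; abel
    rw [this]
    refine (norm_add_le _ _).trans ?_
    rw [norm_smul, norm_smul, hg2, Real.norm_of_nonneg ht0.le, Real.norm_of_nonneg (by linarith)]
  refine ⟨happ.injOn hc, ?_⟩
  apply Subset.antisymm
  · rintro _ ⟨x, hx, rfl⟩
    rw [mem_ball_zero_iff] at hx ⊢
    have := hform x
    refine lt_of_le_of_lt this ?_
    nlinarith
  · have hopen := happ.open_image (ContinuousLinearEquiv.toNonlinearRightInverse _) isOpen_ball hc
    refine (convex_ball (0 : EuclideanSpace ℝ (Fin d)) 2).isPreconnected.subset_of_closure_inter_subset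
      hopen ?_ ?_
    · refine ⟨0 + t • g 0, ?_, ⟨0, by simp, rfl⟩⟩
      rw [mem_ball_zero_iff]
      refine lt_of_le_of_lt (hform 0) ?_
      rw [norm_zero]; linarith
    · rintro y ⟨hy, hyb⟩
      have hcl : IsClosed ((fun x => x + t • g x) '' closedBall 0 2) :=
        ((isCompact_closedBall _ _).image (by fun_prop)).isClosed
      obtain ⟨x, hx, rfl⟩ := closure_minimal (image_mono ball_subset_closedBall) hcl hy
      refine ⟨x, ?_, rfl⟩
      rw [mem_closedBall_zero_iff] at hx
      rw [mem_ball_zero_iff] at hyb ⊢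
      refine lt_of_le_of_ne hx fun h => ?_
      simp only [hg0 x h, smul_zero, add_zero] at hyb
      linarith

theorem br_no_retraction {d : ℕ} (r : EuclideanSpace ℝ (Fin d) → EuclideanSpace ℝ (Fin d))
    (hr : ContDiff ℝ 1 r) (hr1 : ∀ x, ‖x‖ = 2 → r x = x) (hr2 : ∀ x, ‖r x‖ = 2) : False := by
  set g : EuclideanSpace ℝ (Fin d) → EuclideanSpace ℝ (Fin d) := fun x => r x - x with hg
  have hgC : ContDiff ℝ 1 g := hr.sub contDiff_id
  have hgd : Continuous (fderiv ℝ g) := hgC.continuous_fderiv one_ne_zero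
  obtain ⟨K0, hK0⟩ := (isCompact_closedBall (0 : EuclideanSpace ℝ (Fin d)) 2).exists_bound_of_continuousOn
    hgd.continuousOn
  set K : NNReal := K0.toNNReal with hKdef
  have hKb : ∀ x ∈ closedBall (0 : EuclideanSpace ℝ (Fin d)) 2, ‖fderiv ℝ g x‖ ≤ K :=
    fun x hx => (hK0 x hx).trans (Real.le_coe_toNNReal _)
  have hK : LipschitzOnWith K g (closedBall 0 2) :=
    Convex.lipschitzOnWith_of_nnnorm_fderiv_le (fun x _ => (hgC.differentiable one_ne_zero) x)
      (fun x hx => by exact_mod_cast hKb x hx) (convex_closedBall _ _)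
  -- determinants near the identity are positive
  have hdetc := ContinuousLinearMap.continuous_det (𝕜 := ℝ) (E := EuclideanSpace ℝ (Fin d))
  obtain ⟨ε, hε, hdet⟩ : ∃ ε > 0, ∀ B : EuclideanSpace ℝ (Fin d) →L[ℝ] EuclideanSpace ℝ (Fin d),
      dist B (ContinuousLinearMap.id ℝ _) < ε → 0 < B.det := by
    have := (hdetc.continuousAt (x := ContinuousLinearMap.id ℝ (EuclideanSpace ℝ (Fin d)))).eventually
      (lt_mem_nhds (a := 0) (by simp [ContinuousLinearMap.det]))
    obtain ⟨ε, hε, h⟩ := Metric.eventually_nhds_iff.1 this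
    exact ⟨ε, hε, fun B hB => h hB⟩
  set T : ℝ := min 1 ε / (K + 1) with hT
  have hKp : (0 : ℝ) < K + 1 := by positivity
  have hTp : 0 < T := by positivity
  have hcont : ∀ t : ℝ, Continuous fun x =>
      (ContinuousLinearMap.id ℝ (EuclideanSpace ℝ (Fin d)) + t • fderiv ℝ g x).det := fun t =>
    hdetc.comp (by fun_prop)
  have hint : ∀ t : ℝ, IntegrableOn (fun x =>
      (ContinuousLinearMap.id ℝ (EuclideanSpace ℝ (Fin d)) + t • fderiv ℝ g x).det)
      (ball 0 2) volume := fun t =>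
    ((hcont t).continuousOn.integrableOn_compact (isCompact_closedBall 0 2)).mono_set
      ball_subset_closedBall
  have hsmall : ∀ t : ℝ, 0 < t → t < T →
      ∫ x in ball 0 2, (ContinuousLinearMap.id ℝ (EuclideanSpace ℝ (Fin d)) + t • fderiv ℝ g x).det
        = volume.real (ball (0 : EuclideanSpace ℝ (Fin d)) 2) := by
    intro t ht htT
    have hlt : t * (K + 1) < min 1 ε := (lt_div_iff₀ hKp).1 htT
    have hl1 := hlt.trans_le (min_le_left _ _)
    have hl2 := hlt.trans_le (min_le_right _ _)
    have hKn : (0 : ℝ) ≤ t * K := by positivity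
    obtain ⟨hinj, himg⟩ := br_image g K hgC.continuous hK (fun x hx => by simp [hg, hr1 x hx])
      (fun x => by simp [hg, hr2]) t ht (by nlinarith) (by nlinarith)
    have hcv := integral_image_eq_integral_abs_det_fderiv_smul volume (s := ball 0 2)
      (f := fun x => x + t • g x)
      (f' := fun x => ContinuousLinearMap.id ℝ (EuclideanSpace ℝ (Fin d)) + t • fderiv ℝ g x)
      measurableSet_ball (fun x _ => (((hasFDerivAt_id x).add
        (((hgC.differentiable one_ne_zero) x).hasFDerivAt.const_smul t)).hasFDerivWithinAt))
      hinj (fun _ => (1 : ℝ))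
    rw [himg] at hcv
    simp only [integral_const, smul_eq_mul, mul_one, measureReal_restrict_apply_univ] at hcv
    rw [hcv]
    refine setIntegral_congr_fun measurableSet_ball fun x hx => ?_
    refine (abs_of_pos (hdet _ ?_)).symm
    rw [dist_eq_norm, add_sub_cancel_left, norm_smul, Real.norm_of_nonneg ht.le]
    have := mul_le_mul_of_nonneg_left (hKb x (ball_subset_closedBall hx)) ht.le
    linarith
  set v : ℕ → ℝ := fun i => T / (i + 2) with hv
  have hvinj : InjOn v (Finset.range (d + 1) : Finset ℕ) := by
    intro i _ j _ hij
    simp only [hv] at hij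
    rw [div_eq_div_iff (by positivity) (by positivity)] at hij
    have := mul_left_cancel₀ hTp.ne' hij
    exact_mod_cast (by linarith : (i : ℝ) = j)
  have hone : ∫ x in ball 0 2,
      (ContinuousLinearMap.id ℝ (EuclideanSpace ℝ (Fin d)) + (1 : ℝ) • fderiv ℝ g x).det
        = volume.real (ball (0 : EuclideanSpace ℝ (Fin d)) 2) := by
    simp_rw [fun x => br_det_interp (fderiv ℝ g x) v hvinj 1]
    rw [integral_finsetSum _ (fun i _ => (hint (v i)).const_mul _)]
    simp_rw [integral_const_mul]
    rw [Finset.sum_congr rfl (fun i _ => by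
      rw [hsmall (v i) (by positivity) (div_lt_self hTp (by
        have : (0 : ℝ) ≤ i := Nat.cast_nonneg i
        linarith))])]
    rw [← Finset.sum_mul, ← Polynomial.eval_finsetSum, Lagrange.sum_basis hvinj (by simp)]
    simp
  have hzero : ∀ x, (ContinuousLinearMap.id ℝ (EuclideanSpace ℝ (Fin d)) + (1 : ℝ) • fderiv ℝ g x).det = 0 := by
    intro x
    have hrd : HasFDerivAt r (fderiv ℝ r x) x := ((hr.differentiable one_ne_zero) x).hasFDerivAt
    have hgr : ContinuousLinearMap.id ℝ (EuclideanSpace ℝ (Fin d)) + (1 : ℝ) • fderiv ℝ g x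
        = fderiv ℝ r x := by
      have h0 : fderiv ℝ g x = fderiv ℝ r x - ContinuousLinearMap.id ℝ _ :=
        (hrd.sub (hasFDerivAt_id x)).fderiv
      rw [h0, one_smul]; abel
    rw [hgr]
    by_contra hne
    have hu : IsUnit (LinearMap.det (fderiv ℝ r x : EuclideanSpace ℝ (Fin d) →ₗ[ℝ] EuclideanSpace ℝ (Fin d))) :=
      isUnit_iff_ne_zero.2 hne
    obtain ⟨w, hw⟩ := (LinearMap.equivOfIsUnitDet hu).surjective (r x)
    have hw' : fderiv ℝ r x w = r x := by simpa using hw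
    have h1 := hrd.norm_sq
    have h2 : (fun y => ‖r y‖ ^ 2) = fun _ => (4 : ℝ) := by
      funext y; rw [hr2]; norm_num
    rw [h2] at h1
    have h3 := congrArg (fun L => L w) (h1.unique (hasFDerivAt_const _ _))
    simp [hw', hr2] at h3
  simp_rw [hzero] at hone
  have hpos : 0 < volume.real (ball (0 : EuclideanSpace ℝ (Fin d)) 2) :=
    ENNReal.toReal_pos (measure_ball_pos _ _ (by norm_num)).ne' measure_ball_lt_top.ne
  simp at hone
  rw [← hone] at hpos
  exact lt_irrefl _ hpos

theorem br_brouwer {d : ℕ} (f : EuclideanSpace ℝ (Fin d) → EuclideanSpace ℝ (Fin d))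
    (hf : ContinuousOn f (closedBall 0 1)) (hm : MapsTo f (closedBall 0 1) (closedBall 0 1)) :
    ∃ x ∈ closedBall (0 : EuclideanSpace ℝ (Fin d)) 1, f x = x := by
  by_contra hcon
  push Not at hcon
  obtain ⟨x0, hx0, hmin⟩ := (isCompact_closedBall (0 : EuclideanSpace ℝ (Fin d)) 1).exists_isMinOn
    ⟨0, by simp⟩ (f := fun x => ‖f x - x‖) (hf.sub continuousOn_id).norm
  set δ := ‖f x0 - x0‖ with hδ
  have hδp : 0 < δ := norm_pos_iff.2 (sub_ne_zero.2 (hcon x0 hx0))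
  set p : EuclideanSpace ℝ (Fin d) → EuclideanSpace ℝ (Fin d) := fun x => (max 1 ‖x‖)⁻¹ • x with hp
  have hmx : ∀ x : EuclideanSpace ℝ (Fin d), 0 < max 1 ‖x‖ := fun x => lt_max_of_lt_left one_pos
  have hpc : Continuous p := by
    refine Continuous.smul (Continuous.inv₀ (by fun_prop) fun x => (hmx x).ne') continuous_id
  have hpm : ∀ x, p x ∈ closedBall (0 : EuclideanSpace ℝ (Fin d)) 1 := by
    intro x
    rw [mem_closedBall_zero_iff, norm_smul, norm_inv, Real.norm_of_nonneg (hmx x).le,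
      inv_mul_le_iff₀ (hmx x), mul_one]
    exact le_max_right _ _
  have hpid : ∀ x ∈ closedBall (0 : EuclideanSpace ℝ (Fin d)) 1, p x = x := by
    intro x hx
    rw [mem_closedBall_zero_iff] at hx
    simp [hp, max_eq_left hx]
  have hF : Continuous fun x => f (p x) := hf.comp_continuous hpc hpm
  obtain ⟨P, hP⟩ := exists_contMDiffMap_forall_mem_convex_of_local_const
    (modelWithCornersSelf ℝ (EuclideanSpace ℝ (Fin d))) (n := ((1 : ℕ) : ℕ∞))
    (t := fun x => ball (f (p x)) δ ∩ closedBall (0 : EuclideanSpace ℝ (Fin d)) 1)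
    (fun x => (convex_ball _ _).inter (convex_closedBall _ _))
    (fun x => ⟨f (p x), by
      filter_upwards [hF.continuousAt.eventually (ball_mem_nhds (f (p x)) hδp)] with y hy
      exact ⟨by rw [mem_ball_comm]; exact hy, hm (hpm x)⟩⟩)
  have hPc : ContDiff ℝ 1 P := P.contMDiff.contDiff
  let χ : ContDiffBump (0 : EuclideanSpace ℝ (Fin d)) := ⟨1, 2, one_pos, one_lt_two⟩
  have hχc : ContDiff ℝ 1 χ := χ.contDiff
  set H : EuclideanSpace ℝ (Fin d) → EuclideanSpace ℝ (Fin d) := fun x => x - χ x • P x with hH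
  have hHc : ContDiff ℝ 1 H := contDiff_id.sub (hχc.smul hPc)
  have hH0 : ∀ x, H x ≠ 0 := by
    intro x hx
    have hx' : x = χ x • P x := sub_eq_zero.1 hx
    obtain ⟨hPb, hP1⟩ := hP x
    rw [mem_closedBall_zero_iff] at hP1
    have hx1 : x ∈ closedBall (0 : EuclideanSpace ℝ (Fin d)) 1 := by
      rw [mem_closedBall_zero_iff, hx', norm_smul, Real.norm_of_nonneg χ.nonneg]
      exact mul_le_one₀ χ.le_one (norm_nonneg _) hP1
    rw [χ.one_of_mem_closedBall hx1, one_smul] at hx'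
    rw [← hx', hpid x hx1, mem_ball, dist_comm, dist_eq_norm] at hPb
    exact absurd (hmin hx1) (not_le.2 hPb)
  refine br_no_retraction (fun x => (2 * ‖H x‖⁻¹) • H x) ?_ ?_ ?_
  · exact (contDiff_const.mul ((hHc.norm ℝ hH0).inv fun x => norm_ne_zero_iff.2 (hH0 x))).smul hHc
  · intro x hx
    have : H x = x := by
      have : χ x = 0 := χ.zero_of_le_dist (by simp [χ, hx])
      simp [hH, this]
    simp only [this, hx]; norm_num
  · intro x
    have := norm_ne_zero_iff.2 (hH0 x)
    rw [norm_smul, norm_mul, norm_inv, norm_norm, mul_assoc, inv_mul_cancel₀ this]; norm_num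

theorem stmt_11 (d : ℕ) (Y : Set (EuclideanSpace ℝ (Fin d))) (hY : IsOpen Y)
    (G Ginv : EuclideanSpace ℝ (Fin d) → EuclideanSpace ℝ (Fin d))
    (Gh : ℝ → EuclideanSpace ℝ (Fin d) → EuclideanSpace ℝ (Fin d))
    (yex : EuclideanSpace ℝ (Fin d)) (hyex : yex ∈ Y)
    (hGcont : ContinuousOn G Y)
    (hzero : G yex = 0) (huniq : ∀ y ∈ Y, G y = 0 → y = yex)
    (V : Set (EuclideanSpace ℝ (Fin d))) (hV : V ∈ nhds (0 : EuclideanSpace ℝ (Fin d)))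
    (hGinvCont : ContinuousOn Ginv V)
    (hInv : ∀ b ∈ V, G (Ginv b) = b ∧ Ginv b ∈ Y)
    (C M k : ℝ) (hC : 0 < C) (hM : 0 < M) (hk : 0 < k)
    (hLip : ∀ b ∈ V, ‖Ginv b - yex‖ ≤ C * ‖b‖)
    (hGhCont : ∀ h : ℝ, 0 < h → ContinuousOn (Gh h) Y)
    (hApprox : ∀ h : ℝ, 0 < h → ∀ y ∈ Y, ‖G y - Gh h y‖ ≤ M * h ^ k) :
    ∃ h₀ > 0, ∀ h : ℝ, 0 < h → h < h₀ →
      ∃ yh ∈ Y, Gh h yh = 0 ∧ ‖yh - yex‖ ≤ C * M * h ^ k := by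
  
  obtain ⟨ε, hε, hεV⟩ := Metric.mem_nhds_iff.1 hV
  have hlim : Filter.Tendsto (fun h : ℝ => M * h ^ k) (nhds 0) (nhds 0) := by
    have := ((Real.continuousAt_rpow_const 0 k (Or.inr hk.le)).tendsto).const_mul M
    simpa [Real.zero_rpow hk.ne'] using this
  obtain ⟨h₀, hh₀, hsm⟩ := Metric.eventually_nhds_iff.1 (hlim.eventually (gt_mem_nhds hε))
  refine ⟨h₀, hh₀, fun h hh hlt => ?_⟩
  have hρ : M * h ^ k < ε := hsm (by simpa [abs_of_pos hh] using hlt)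
  have hρp : 0 < M * h ^ k := mul_pos hM (Real.rpow_pos_of_pos hh k)
  set ρ := M * h ^ k with hρd
  have hsc : ∀ x ∈ closedBall (0 : EuclideanSpace ℝ (Fin d)) 1, ‖ρ • x‖ ≤ ρ := by
    intro x hx
    rw [mem_closedBall_zero_iff] at hx
    rw [norm_smul, Real.norm_of_nonneg hρp.le]
    exact mul_le_of_le_one_right hρp.le hx
  have hscV : MapsTo (fun x => ρ • x) (closedBall (0 : EuclideanSpace ℝ (Fin d)) 1) V :=
    fun x hx => hεV (mem_ball_zero_iff.2 ((hsc x hx).trans_lt hρ))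
  have hc1 : ContinuousOn (fun x => Ginv (ρ • x)) (closedBall (0 : EuclideanSpace ℝ (Fin d)) 1) :=
    hGinvCont.comp (by fun_prop) hscV
  have hc2 : ContinuousOn (fun x => Gh h (Ginv (ρ • x)))
      (closedBall (0 : EuclideanSpace ℝ (Fin d)) 1) :=
    (hGhCont h hh).comp hc1 fun x hx => (hInv _ (hscV hx)).2
  obtain ⟨x, hx, hfix⟩ := br_brouwer (fun x => ρ⁻¹ • (ρ • x - Gh h (Ginv (ρ • x))))
    (ContinuousOn.fun_const_smul (ContinuousOn.fun_sub
      (ContinuousOn.fun_const_smul continuousOn_id ρ) hc2) _) (by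
      intro x hx
      obtain ⟨h1, h2⟩ := hInv _ (hscV hx)
      have h3 := hApprox h hh _ h2
      rw [h1] at h3
      rw [mem_closedBall_zero_iff, norm_smul, norm_inv, Real.norm_of_nonneg hρp.le,
        inv_mul_le_iff₀ hρp, mul_one]
      exact h3)
  refine ⟨Ginv (ρ • x), (hInv _ (hscV hx)).2, ?_, ?_⟩
  · have h1 : ρ • x - Gh h (Ginv (ρ • x)) = ρ • x := by
      have := congrArg (fun z => ρ • z) hfix
      simpa [smul_smul, mul_inv_cancel₀ hρp.ne'] using this
    simpa using h1
  · refine (hLip _ (hscV hx)).trans ?_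
    rw [mul_assoc]
    exact mul_le_mul_of_nonneg_left (hsc x hx) hC.le
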